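/- 9√3/(2^{4/3}·π) = ∑_{n=0}^∞ (−1/27)^n · [(1/3)_n (2/3)_n (1/6)_n / ((1)_n³)] · (2 + 21n). -/

import Mathlib

open Real

/-- Pochhammer symbol (x)_n = x (x+1) ⋯ (x+n-1). -/
noncomputable def poch (x : ℝ) (n : ℕ) : ℝ :=
  ∏ k ∈ Finset.range n, (x + k)

open Filter Topology

/-- ratio in K -/
noncomputable def rK (N k : ℕ) : ℝ :=
  (1/3 + k) * (2/3 + k) * (1/6 + k) / ((1 + k) * (2*N+2+k) * (k - 2/3 - 2*N))

noncomputable def aN (N : ℕ) : ℝ :=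
  ∏ i ∈ Finset.range N, (((i:ℝ) + 4/3) * (2*i+5/3) * (2*i+8/3) / ((i+1) * (2*i+2) * (2*i+3)))

noncomputable def phi (N K : ℕ) : ℝ := aN N * ∏ k ∈ Finset.range K, rK N k

noncomputable def dd (n : ℕ) : ℝ :=
  (-1/27 : ℝ) ^ n * (poch (1/3) n * poch (2/3) n * poch (1/6) n / poch 1 n ^ 3)

lemma phi_succ (N K : ℕ) : phi N (K+1) = phi N K * rK N K := by
  simp only [phi, Finset.prod_range_succ]; ring

lemma den_ne (N k : ℕ) : (k:ℝ) - 2/3 - 2*N ≠ 0 := by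
  intro h
  have h2 : (3*k:ℝ) = 2 + 6*N := by linarith
  have h3 : 3*k = 2 + 6*N := by exact_mod_cast h2
  omega

lemma phi_N (N K : ℕ) : phi (N+1) K = phi N K *
    (((N:ℝ)+4/3)*(2*N+5/3-K)*(2*N+8/3-K)/((N+1)*(2*N+2+K)*(2*N+3+K))) := by
  induction K with
  | zero =>
    simp only [phi, aN, Finset.prod_range_succ, Finset.prod_range_zero]
    push_cast
    ring
  | succ K ih =>
    rw [phi_succ, phi_succ, ih, mul_assoc (phi N K), mul_assoc (phi N K)]
    congr 1
    have h1 := den_ne N K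
    have h2 := den_ne (N+1) K
    simp only [rK]
    push_cast at *
    have e1 : (K:ℝ) - 2/3 - 2*N = -(2*N+5/3-(K+1)) := by ring
    have e2 : (K:ℝ) - 2/3 - 2*(N+1) = -(2*N+8/3-K) := by ring
    have e3 : (2*N+8/3-((K:ℝ)+1)) = 2*N+5/3-K := by ring
    rw [e1] at h1
    rw [e2] at h2
    rw [e1, e2, e3]
    have h1' := neg_ne_zero.mp h1
    have h2' := neg_ne_zero.mp h2
    have p1 : (N:ℝ)+1 ≠ 0 := by positivity
    have p2 : (2*N:ℝ)+2+K ≠ 0 := by positivity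
    have p3 : (2*N:ℝ)+3+K ≠ 0 := by positivity
    have p4 : (2*N:ℝ)+2+(K+1) ≠ 0 := by positivity
    have p5 : (2*N:ℝ)+3+(K+1) ≠ 0 := by positivity
    have p6 : (2*(N+1):ℝ)+2+K ≠ 0 := by positivity
    have p7 : (1:ℝ)+K ≠ 0 := by positivity
    generalize hX : (2*(N:ℝ)+8/3-K) = X at *
    generalize hY : (2*(N:ℝ)+5/3-(K+1)) = Y at *
    rw [mul_neg, mul_neg, div_neg, div_neg, mul_neg, neg_mul, neg_inj, div_mul_div_comm, div_mul_div_comm,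
      div_eq_div_iff (by positivity) (by positivity)]
    ring

noncomputable def gg (N K : ℕ) : ℝ :=
  phi N K * (K * (4*N+10/3-2*K) / ((N+1)*(2*N+2+K)))

lemma wz (N K : ℕ) : phi (N+1) K - phi N K = gg N (K+1) - gg N K := by
  rw [gg, gg, phi_succ, phi_N, rK]
  have h1 := den_ne N K
  have p1 : (N:ℝ)+1 ≠ 0 := by positivity
  have p2 : (2*N:ℝ)+2+K ≠ 0 := by positivity
  have p3 : (2*N:ℝ)+3+K ≠ 0 := by positivity
  have p7 : (1:ℝ)+K ≠ 0 := by positivity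
  push_cast
  have p4 : (2*N:ℝ)+2+(K+1) = 2*N+3+K := by ring
  have e : (4*N+10/3-2*((K:ℝ)+1)) = -2*(K - 2/3 - 2*N) := by ring
  rw [p4, e]
  have e2 : (K:ℝ) + 1 = 1 + K := by ring
  rw [e2]
  have : (1/3 + (K:ℝ)) * (2/3 + K) * (1/6 + K) / ((1 + K) * (2*N+2+K) * (K - 2/3 - 2*N)) *
      ((1+K) * (-2*(K - 2/3 - 2*N)) / ((N+1)*(2*N+3+K))) =
      -2*((1/3 + (K:ℝ)) * (2/3 + K) * (1/6 + K)) / ((N+1)*(2*N+2+K)*(2*N+3+K)) := by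
    generalize (K:ℝ) - 2/3 - 2*N = X at *
    field_simp
  rw [mul_assoc (phi N K), this]
  field_simp
  ring

lemma wz_sum (N M : ℕ) :
    ∑ K ∈ Finset.range M, phi (N+1) K = ∑ K ∈ Finset.range M, phi N K + gg N M := by
  induction M with
  | zero => simp [gg]
  | succ M ih =>
    rw [Finset.sum_range_succ, Finset.sum_range_succ, ih]
    linarith [wz N M]

lemma poch_succ (x : ℝ) (n : ℕ) : poch x (n+1) = poch x n * (x + n) := by
  simp [poch, Finset.prod_range_succ]

lemma poch_pos {x : ℝ} (hx : 0 < x) (n : ℕ) : 0 < poch x n :=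
  Finset.prod_pos fun k _ => by positivity

lemma dd_succ (n : ℕ) : dd (n+1) = dd n *
    (-1/27 * ((1/3+n)*(2/3+n)*(1/6+n)/(1+n)^3)) := by
  have := (poch_pos one_pos n).ne'
  have p7 : (1:ℝ)+n ≠ 0 := by positivity
  simp only [dd, poch_succ, pow_succ]
  field_simp

lemma phi_diag (n : ℕ) : phi n n = dd n * (1 + 3*n/2) := by
  induction n with
  | zero => simp [phi, aN, dd, poch]
  | succ n ih =>
    rw [phi_N, phi_succ, ih, dd_succ, rK]
    push_cast
    have e : (n:ℝ) - 2/3 - 2*n = -(n+2/3) := by ring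
    rw [e]
    have p7 : (1:ℝ)+n ≠ 0 := by positivity
    have p8 : (n:ℝ)+2/3 ≠ 0 := by positivity
    have p1 : (2*n:ℝ)+2+n ≠ 0 := by positivity
    have p2 : (2*n:ℝ)+2+(n+1) ≠ 0 := by positivity
    have p3 : (2*n:ℝ)+3+(n+1) ≠ 0 := by positivity
    field_simp
    ring

lemma step (n : ℕ) : phi (n+1) (n+1) + gg n (n+1) = dd (n+1) * (2 + 21*((n+1:ℕ):ℝ)) / 2 := by
  have h := phi_diag (n+1)
  have h2 := phi_N n (n+1)
  rw [h] at h2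
  rw [h, gg]
  push_cast at *
  have p7 : (1:ℝ)+n ≠ 0 := by positivity
  have p8 : (n:ℝ)+2/3 ≠ 0 := by positivity
  have p9 : (n:ℝ)+5/3 ≠ 0 := by positivity
  have p10 : (n:ℝ)+4/3 ≠ 0 := by positivity
  have p2 : (2*n:ℝ)+2+(n+1) ≠ 0 := by positivity
  have p3 : (2*n:ℝ)+3+(n+1) ≠ 0 := by positivity
  have e1 : (2*n:ℝ)+5/3-(n+1) = n+2/3 := by ring
  have e2 : (2*n:ℝ)+8/3-(n+1) = n+5/3 := by ring
  rw [e1, e2] at h2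
  have h3 : phi n (n+1) = dd (n+1) * (1 + 3*(n+1)/2) / (((n:ℝ)+4/3)*(n+2/3)*(n+5/3)/((n+1)*(2*n+2+(n+1))*(2*n+3+(n+1)))) := by
    rw [eq_div_iff (by positivity), h2]
  rw [h3]
  field_simp
  ring

lemma partial_sum (M : ℕ) : ∑ n ∈ Finset.range (M+1), dd n * (2 + 21*(n:ℝ)) =
    2 * ∑ K ∈ Finset.range (M+1), phi M K := by
  induction M with
  | zero => simp [phi, aN, dd, poch]
  | succ M ih =>
    rw [Finset.sum_range_succ, ih, Finset.sum_range_succ _ (M+1), wz_sum]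
    linarith [step M]

lemma rK_bound {N k : ℕ} (h : k < N) : |rK N k| ≤ 1/2 := by
  have h' : (k:ℝ) + 1 ≤ N := by exact_mod_cast h
  have hk : (0:ℝ) ≤ k := by positivity
  have e : rK N k = -(((1/3+k)/(1+k)) * ((2/3+k)/(2*N+2+k)) * ((1/6+k)/(2*N+2/3-k))) := by
    have h1 := den_ne N k
    have e1 : (k:ℝ) - 2/3 - 2*N = -(2*N+2/3-k) := by ring
    rw [rK, e1, div_mul_div_comm, div_mul_div_comm, mul_neg, div_neg]
  have q1 : (1/3+(k:ℝ))/(1+k) ≤ 1 := by rw [div_le_one (by positivity)]; linarith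
  have q2 : (2/3+(k:ℝ))/(2*N+2+k) ≤ 1/2 := by rw [div_le_div_iff₀ (by positivity) (by norm_num)]; linarith
  have hp : (0:ℝ) < 2*N+2/3-k := by linarith
  have q3 : (1/6+(k:ℝ))/(2*N+2/3-k) ≤ 1 := by rw [div_le_one hp]; linarith
  have n3 : 0 ≤ (1/6+(k:ℝ))/(2*N+2/3-k) := by positivity
  rw [e, abs_neg, abs_of_nonneg (by positivity)]
  calc _ ≤ (1:ℝ) * (1/2) * 1 := by gcongr
    _ = 1/2 := by norm_num

lemma rK_zero (N : ℕ) : |rK N 0| ≤ 1/((N:ℝ)+1) := by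
  have e : rK N 0 = -((1/27)/((2*N+2)*(2*N+2/3))) := by
    have e1 : ((0:ℕ):ℝ) - 2/3 - 2*N = -(2*N+2/3) := by push_cast; ring
    rw [rK, e1, mul_neg, div_neg]
    push_cast
    norm_num
  have hN : (0:ℝ) ≤ N := by positivity
  rw [e, abs_neg, abs_of_nonneg (by positivity), div_le_div_iff₀ (by positivity) (by positivity)]
  nlinarith

lemma aN_pos (N : ℕ) : 0 < aN N := Finset.prod_pos fun i _ => by positivity

lemma phi_bound (N K : ℕ) (h : K + 1 ≤ N) : |phi N (K+1)| ≤ aN N * (1/((N:ℝ)+1)) * (1/2)^K := by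
  induction K with
  | zero =>
    rw [phi_succ, abs_mul]
    simp only [phi, Finset.prod_range_zero, mul_one, pow_zero, abs_of_pos (aN_pos N)]
    exact mul_le_mul_of_nonneg_left (rK_zero N) (aN_pos N).le
  | succ K ih =>
    rw [phi_succ, abs_mul, pow_succ, ← mul_assoc]
    have := aN_pos N
    exact mul_le_mul (ih (by omega)) (rK_bound (by omega)) (abs_nonneg _) (by positivity)

lemma sum_bound (N : ℕ) : |∑ K ∈ Finset.range (N+1), phi N K - aN N| ≤ aN N * (1/((N:ℝ)+1)) * 2 := by
  have hp := aN_pos N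
  rw [Finset.sum_range_succ']
  have : phi N 0 = aN N := by simp [phi]
  rw [this, add_sub_cancel_right]
  calc _ ≤ ∑ K ∈ Finset.range N, |phi N (K+1)| := Finset.abs_sum_le_sum_abs _ _
    _ ≤ ∑ K ∈ Finset.range N, aN N * (1/((N:ℝ)+1)) * (1/2)^K := by
      apply Finset.sum_le_sum
      intro K hK
      exact phi_bound N K (Finset.mem_range.mp hK)
    _ = aN N * (1/((N:ℝ)+1)) * ∑ K ∈ Finset.range N, (1/2:ℝ)^K := by rw [Finset.mul_sum]
    _ ≤ _ := by
      apply mul_le_mul_of_nonneg_left _ (by positivity)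
      exact sum_geometric_two_le N

lemma aN_closed (N : ℕ) : aN N = 9/2 * (∏ j ∈ Finset.range (N+1), ((1/3:ℝ)+j)) *
    (∏ j ∈ Finset.range (2*N+1), ((2/3:ℝ)+j)) / ((2*N+1) * (2*N).factorial * N.factorial) := by
  induction N with
  | zero => simp [aN]; norm_num
  | succ N ih =>
    have e : aN (N+1) = aN N * (((N:ℝ) + 4/3) * (2*N+5/3) * (2*N+8/3) / ((N+1) * (2*N+2) * (2*N+3))) := by
      rw [aN, Finset.prod_range_succ, ← aN]
    rw [e, ih, Finset.prod_range_succ _ (N+1), show 2*(N+1)+1 = 2*N+1+1+1 by ring,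
      Finset.prod_range_succ _ (2*N+1+1), Finset.prod_range_succ _ (2*N+1),
      show 2*(N+1) = 2*N+1+1 by ring, Nat.factorial_succ, Nat.factorial_succ, Nat.factorial_succ]
    generalize (∏ j ∈ Finset.range (N+1), ((1/3:ℝ)+j)) = X
    generalize (∏ j ∈ Finset.range (2*N+1), ((2/3:ℝ)+j)) = Y
    have f1 : ((2*N).factorial:ℝ) ≠ 0 := by positivity
    have f2 : (N.factorial:ℝ) ≠ 0 := by positivity
    push_cast
    field_simp
    ring

lemma aN_gamma (N : ℕ) (hN : 0 < N) : aN N =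
    9/2 * (2:ℝ)^((2:ℝ)/3) * (N/(2*N+1)) / (Real.GammaSeq (1/3) N * Real.GammaSeq (2/3) (2*N)) := by
  rw [aN_closed, Real.GammaSeq, Real.GammaSeq]
  have hp : (0:ℝ) < N := by exact_mod_cast hN
  have hX : (∏ j ∈ Finset.range (N+1), ((1/3:ℝ)+j)) ≠ 0 := (Finset.prod_pos fun k _ => by positivity).ne'
  have hY : (∏ j ∈ Finset.range (2*N+1), ((2/3:ℝ)+j)) ≠ 0 := (Finset.prod_pos fun k _ => by positivity).ne'
  have f1 : ((2*N).factorial:ℝ) ≠ 0 := by positivity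
  have f2 : (N.factorial:ℝ) ≠ 0 := by positivity
  generalize (∏ j ∈ Finset.range (N+1), ((1/3:ℝ)+j)) = X at *
  generalize (∏ j ∈ Finset.range (2*N+1), ((2/3:ℝ)+j)) = Y at *
  push_cast
  rw [Real.mul_rpow (by norm_num) hp.le]
  have e : (N:ℝ) = (N:ℝ)^((1:ℝ)/3) * (N:ℝ)^((2:ℝ)/3) := by
    rw [← Real.rpow_add hp]; norm_num
  have g1 : (N:ℝ)^((1:ℝ)/3) ≠ 0 := by positivity
  have g2 : (N:ℝ)^((2:ℝ)/3) ≠ 0 := by positivity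
  have g3 : (2:ℝ)^((2:ℝ)/3) ≠ 0 := by positivity
  have p : (2*(N:ℝ)+1) ≠ 0 := by positivity
  have e' : (N:ℝ)/(2*N+1) = (N:ℝ)^((1:ℝ)/3) * (N:ℝ)^((2:ℝ)/3)/(2*N+1) := by rw [← e]
  rw [e']
  generalize (N:ℝ)^((1:ℝ)/3) = a at *
  generalize (N:ℝ)^((2:ℝ)/3) = b at *
  generalize (2:ℝ)^((2:ℝ)/3) = c at *
  field_simp

lemma gamma_prod : Real.Gamma (1/3) * Real.Gamma (2/3) = 2*π/√3 := by
  have := Real.Gamma_mul_Gamma_one_sub (1/3)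
  rw [show (1:ℝ) - 1/3 = 2/3 by norm_num, show π * (1/3) = π/3 by ring, Real.sin_pi_div_three] at this
  rw [this]
  field_simp

lemma frac_lim : Tendsto (fun N:ℕ => (N:ℝ)/(2*N+1)) atTop (𝓝 (1/2)) := by
  have h := (tendsto_one_div_add_atTop_nhds_zero_nat (𝕜 := ℝ)).comp (tendsto_id.const_mul_atTop' (two_pos : 0 < 2))
  have h2 : Tendsto (fun N:ℕ => 1/2 - 1/2 * (1/(((2*N:ℕ):ℝ)+1))) atTop (𝓝 (1/2 - 1/2*0)) :=
    tendsto_const_nhds.sub (h.const_mul _)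
  rw [mul_zero, sub_zero] at h2
  refine h2.congr fun N => ?_
  push_cast
  field_simp
  ring

lemma aN_lim : Tendsto aN atTop (𝓝 (9 * √3 / ((2 : ℝ) ^ ((4 : ℝ) / 3) * π) / 2)) := by
  have t2 : Tendsto (fun N:ℕ => 2*N) atTop atTop := tendsto_id.const_mul_atTop' two_pos
  have h := ((frac_lim.const_mul (9/2 * (2:ℝ)^((2:ℝ)/3))).div
    ((Real.GammaSeq_tendsto_Gamma (1/3)).mul ((Real.GammaSeq_tendsto_Gamma (2/3)).comp t2))
    (by rw [gamma_prod]; positivity))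
  rw [gamma_prod] at h
  have e : 9/2 * (2:ℝ)^((2:ℝ)/3) * (1/2) / (2*π/√3) = 9 * √3 / ((2 : ℝ) ^ ((4 : ℝ) / 3) * π) / 2 := by
    have : (2:ℝ)^((2:ℝ)/3) * (2:ℝ)^((4:ℝ)/3) = 4 := by
      rw [← Real.rpow_add two_pos]; norm_num
    field_simp
    linear_combination this
  rw [e] at h
  refine h.congr' ?_
  filter_upwards [eventually_gt_atTop 0] with N hN
  rw [aN_gamma N hN]; rfl

lemma sum_lim : Tendsto (fun N => ∑ K ∈ Finset.range (N+1), phi N K) atTop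
    (𝓝 (9 * √3 / ((2 : ℝ) ^ ((4 : ℝ) / 3) * π) / 2)) := by
  have h0 : Tendsto (fun N => aN N * (1/((N:ℝ)+1)) * 2) atTop (𝓝 0) := by
    have := (aN_lim.mul (tendsto_one_div_add_atTop_nhds_zero_nat (𝕜 := ℝ))).mul_const 2
    simpa using this
  have h1 : Tendsto (fun N => ∑ K ∈ Finset.range (N+1), phi N K - aN N) atTop (𝓝 0) :=
    squeeze_zero_norm (fun N => sum_bound N) h0
  have h2 := h1.add aN_lim
  simpa using h2

lemma dd_bound (n : ℕ) : |dd n| ≤ (1/27)^n := by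
  induction n with
  | zero => simp [dd, poch]
  | succ n ih =>
    rw [dd_succ, abs_mul, pow_succ (1/27:ℝ) n]
    apply mul_le_mul ih _ (abs_nonneg _) (by positivity)
    rw [abs_mul]
    have : |(1/3+(n:ℝ))*(2/3+n)*(1/6+n)/(1+n)^3| ≤ 1 := by
      rw [abs_of_nonneg (by positivity), div_le_one (by positivity)]
      have hn : (0:ℝ) ≤ n := by positivity
      calc (1/3+(n:ℝ))*(2/3+n)*(1/6+n) ≤ (1+n)*(1+n)*(1+n) := by gcongr <;> norm_num
        _ = _ := by ring
    have e : |(-1/27:ℝ)| = 1/27 := by rw [abs_of_neg] <;> norm_num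
    rw [e]; linarith

lemma summ : Summable fun n : ℕ => dd n * (2 + 21*(n:ℝ)) := by
  have s1 : Summable fun n : ℕ => (n:ℝ)^1 * (1/27:ℝ)^n :=
    summable_pow_mul_geometric_of_norm_lt_one 1 (by norm_num)
  have s0 : Summable fun n : ℕ => (1/27:ℝ)^n := summable_geometric_of_lt_one (by norm_num) (by norm_num)
  refine Summable.of_norm_bounded ((s0.mul_left 2).add (s1.mul_left 21)) fun n => ?_
  rw [Real.norm_eq_abs, abs_mul, abs_of_nonneg (by positivity : (0:ℝ) ≤ 2 + 21*(n:ℝ))]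
  calc _ ≤ (1/27:ℝ)^n * (2 + 21*(n:ℝ)) := mul_le_mul_of_nonneg_right (dd_bound n) (by positivity)
    _ = _ := by ring

theorem series_9sqrt3 :
    9 * Real.sqrt 3 / ((2 : ℝ) ^ ((4 : ℝ) / 3) * π) = ∑' n : ℕ, (-1/27 : ℝ) ^ n *
      (poch (1/3) n * poch (2/3) n * poch (1/6) n / poch 1 n ^ 3) *
      (2 + 21 * n) := by
  have h1 := (summ.hasSum.tendsto_sum_nat).comp (tendsto_add_atTop_nat 1)
  have h2 := sum_lim.const_mul 2
  have h3 := tendsto_nhds_unique h1 (h2.congr fun M => (partial_sum M).symm)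
  rw [mul_div_cancel₀ _ (two_ne_zero)] at h3
  exact h3.symm
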